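/- Let A ⊆ S² be a Borel measurable set and let σ denote the uniform probability measure on S². Then the μ-measure of the set of directed lines whose entry point X and exit point Y both lie in A equals σ(A)²; that is, μ{(v,z) : X(v,z) ∈ A and Y(v,z) ∈ A} = σ(A)². -/

import Mathlib

open MeasureTheory Metric Real Filter
open scoped ENNReal RealInnerProductSpace Topology

noncomputable section

/-- Euclidean space `ℝⁿ`. -/
abbrev En (n : ℕ) := EuclideanSpace ℝ (Fin n)

/-- The unit sphere `S^{n-1} ⊂ ℝⁿ`. -/
def unitSphere (n : ℕ) : Set (En n) := Metric.sphere 0 1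

/-- The uniform probability (normalized surface) measure on the unit sphere. -/
def sigmaN (n : ℕ) : Measure (En n) :=
  (μH[(n : ℝ) - 1] (unitSphere n))⁻¹ •
    (μH[(n : ℝ) - 1] : Measure (En n)).restrict (unitSphere n)

/-- The open unit disc in the hyperplane orthogonal to `v`. -/
def disc (n : ℕ) (v : En n) : Set (En n) := {z | ⟪v, z⟫ = 0 ∧ ‖z‖ < 1}

/-- Normalized `(n-1)`-dimensional Hausdorff measure on the disc `{z ∈ v⊥ : ‖z‖ < 1}`. -/
def lambdaN (n : ℕ) (v : En n) : Measure (En n) :=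
  (μH[(n : ℝ) - 1] (disc n v))⁻¹ •
    (μH[(n : ℝ) - 1] : Measure (En n)).restrict (disc n v)

/-- The normalized kinematic measure on directed lines meeting the unit sphere,
parametrized by pairs `(v, z)` with `v` the direction and `z ∈ v⊥`, `‖z‖ < 1`. -/
def kinematic (n : ℕ) : Measure (En n × En n) :=
  (sigmaN n).bind (fun v => (Measure.dirac v).prod (lambdaN n v))

/-- The entry point of the line parametrized by `(v, z)` in the unit sphere. -/
def Xpt (n : ℕ) (p : En n × En n) : En n := p.2 - Real.sqrt (1 - ‖p.2‖ ^ 2) • p.1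

/-- The exit point of the line parametrized by `(v, z)` in the unit sphere. -/
def Ypt (n : ℕ) (p : En n × En n) : En n := p.2 + Real.sqrt (1 - ‖p.2‖ ^ 2) • p.1


/-- The orthogonal group of `ℝ³`. -/
abbrev OG := unitary (En 3 →L[ℝ] En 3)

instance : MeasurableSpace OG := borel _
instance : BorelSpace OG := ⟨rfl⟩

instance : ContinuousStar (En 3 →L[ℝ] En 3) :=
  ⟨(ContinuousLinearMap.adjoint : (En 3 →L[ℝ] En 3) ≃ₗᵢ⋆[ℝ] (En 3 →L[ℝ] En 3)).continuous⟩

instance : IsTopologicalGroup OG := inferInstance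

instance : CompactSpace OG := by
  apply isCompact_iff_compactSpace.mp
  apply Metric.isCompact_of_isClosed_isBounded
  · exact isClosed_unitary
  · refine (Metric.isBounded_closedBall (x := (0 : En 3 →L[ℝ] En 3)) (r := 1)).subset ?_
    intro u hu
    rw [mem_closedBall_zero_iff]
    exact CStarRing.norm_of_mem_unitary hu |>.le

/-- The action of the orthogonal group. -/
def act : OG →* (En 3 ≃ₗᵢ[ℝ] En 3) := Unitary.linearIsometryEquiv.toMonoidHom

lemma act_apply (g : OG) (x : En 3) : act g x = (g : En 3 →L[ℝ] En 3) x := rfl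

lemma act_surj (R : En 3 ≃ₗᵢ[ℝ] En 3) : ∃ g : OG, act g = R :=
  ⟨Unitary.linearIsometryEquiv.symm R, by simp [act]⟩

lemma measurable_act : Measurable (fun p : OG × En 3 => act p.1 p.2) := by
  apply Continuous.measurable
  simp only [act_apply]
  fun_prop

/-- The first base point. -/
def e0 : En 3 := !₂[1, 0, 0]

/-- The second base point, with height `t`. -/
def yt (t : ℝ) : En 3 := !₂[t, √(1 - t ^ 2), 0]

lemma norm_e0 : ‖e0‖ = 1 := by
  simp [e0, EuclideanSpace.norm_eq, Fin.sum_univ_three]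

lemma norm_yt {t : ℝ} (h1 : -1 ≤ t) (h2 : t ≤ 1) : ‖yt t‖ = 1 := by
  have : 0 ≤ 1 - t ^ 2 := by nlinarith
  simp [yt, EuclideanSpace.norm_eq, Fin.sum_univ_three, Real.sq_sqrt this]

lemma inner_e0 (x : En 3) : ⟪e0, x⟫ = x 0 := by
  simp [e0, PiLp.inner_apply, Fin.sum_univ_three]

lemma measurable_yt : Measurable yt := by
  apply Continuous.measurable
  unfold yt
  apply (PiLp.continuous_toLp 2 _).comp
  apply continuous_pi
  intro i
  fin_cases i <;> simp <;> fun_prop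

lemma exists_iso (x y : En 3) (hx : ‖x‖ = 1) (hy : ‖y‖ = 1) :
    ∃ R : En 3 ≃ₗᵢ[ℝ] En 3, R e0 = x ∧ R (yt ⟪x, y⟫) = y := by
  have hb := abs_le.mp (abs_real_inner_le_norm x y)
  rw [hx, hy] at hb
  set R1 := Submodule.reflection (ℝ ∙ (x - e0))ᗮ with hR1
  have h1 : R1 x = e0 := Submodule.reflection_sub (by rw [hx, norm_e0])
  set t := ⟪x, y⟫ with ht
  set R2 := Submodule.reflection (ℝ ∙ (R1 y - yt t))ᗮ with hR2
  have h2 : R2 (R1 y) = yt t :=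
    Submodule.reflection_sub (by rw [R1.norm_map, hy, norm_yt] <;> linarith)
  have h3 : R2 e0 = e0 := by
    rw [hR2]
    apply Submodule.reflection_mem_subspace_eq_self
    rw [Submodule.mem_orthogonal_singleton_iff_inner_left, inner_sub_right]
    have : ⟪e0, R1 y⟫ = t := by rw [← h1, R1.inner_map_map]
    rw [this, inner_e0]
    simp [yt]
  refine ⟨(R1.trans R2).symm, ?_, ?_⟩
  · rw [LinearIsometryEquiv.symm_apply_eq]; simp [h1, h3]
  · rw [LinearIsometryEquiv.symm_apply_eq]; simp [h2]

lemma haar_avg {G : Type} [Group G] [TopologicalSpace G] [IsTopologicalGroup G] [CompactSpace G]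
    [SecondCountableTopology G] [MeasurableSpace G] [BorelSpace G]
    (act : G →* (En 3 ≃ₗᵢ[ℝ] En 3)) (measurable_act : Measurable (fun p : G × En 3 => act p.1 p.2))
    (act_surj : ∀ R : En 3 ≃ₗᵢ[ℝ] En 3, ∃ g : G, act g = R)
    (P : Measure (En 3 × En 3)) [IsFiniteMeasure P]
    (hP : ∀ R : En 3 ≃ₗᵢ[ℝ] En 3, P.map (Prod.map R R) = P)
    (hS : ∀ᵐ p ∂P, ‖p.1‖ = 1 ∧ ‖p.2‖ = 1) (F : En 3 × En 3 → ℝ≥0∞) (hF : Measurable F) :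
    (Measure.haar : Measure G) Set.univ * ∫⁻ p, F p ∂P =
      ∫⁻ t, (∫⁻ g : G, F (act g⁻¹ e0, act g⁻¹ (yt t)) ∂Measure.haar)
        ∂(P.map (fun p => ⟪p.1, p.2⟫)) := by
  have act_mul (g h : G) (x : En 3) : act (g * h) x = act g (act h x) := by simp
  have hm : Measurable (fun q : (En 3 × En 3) × G => F (act q.2⁻¹ q.1.1, act q.2⁻¹ q.1.2)) := by
    apply hF.comp
    apply Measurable.prodMk
    · exact measurable_act.comp (f := fun q : (En 3 × En 3) × G => (q.2⁻¹, q.1.1)) (by fun_prop)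
    · exact measurable_act.comp (f := fun q : (En 3 × En 3) × G => (q.2⁻¹, q.1.2)) (by fun_prop)
  have hin : Measurable (fun p : En 3 × En 3 => ⟪p.1, p.2⟫) := by fun_prop
  rw [lintegral_map (f := fun t => ∫⁻ g : G, F (act g⁻¹ e0, act g⁻¹ (yt t)) ∂Measure.haar) ?_ hin]
  · have h1 : ∀ g : G, ∫⁻ p, F (act g⁻¹ p.1, act g⁻¹ p.2) ∂P = ∫⁻ p, F p ∂P := by
      intro g
      conv_rhs => rw [← hP (act g⁻¹)]
      rw [lintegral_map hF]
      · rfl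
      · have := (act g⁻¹).continuous
        exact (Continuous.prodMap this this).measurable
    calc _ = ∫⁻ g : G, ∫⁻ p, F (act g⁻¹ p.1, act g⁻¹ p.2) ∂P ∂Measure.haar := by
            simp_rw [h1]; rw [lintegral_const, mul_comm]
      _ = ∫⁻ p, ∫⁻ g : G, F (act g⁻¹ p.1, act g⁻¹ p.2) ∂Measure.haar ∂P := by
            rw [lintegral_lintegral_swap]
            exact (hm.comp measurable_swap).aemeasurable
      _ = _ := by
            apply lintegral_congr_ae
            filter_upwards [hS] with p hp
            obtain ⟨R, hR1, hR2⟩ := exists_iso p.1 p.2 hp.1 hp.2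
            obtain ⟨h, rfl⟩ := act_surj R
            rw [← lintegral_mul_left_eq_self (μ := Measure.haar)
              (fun g : G => F (act g⁻¹ p.1, act g⁻¹ p.2)) h]
            congr 1
            ext g
            rw [mul_inv_rev, act_mul, act_mul]
            have h3 : ∀ x, act h⁻¹ (act h x) = x := fun x => by
              rw [← act_mul, inv_mul_cancel]; simp
            have h4 := h3 e0
            have h5 := h3 (yt ⟪p.1, p.2⟫)
            rw [hR1] at h4
            rw [hR2] at h5
            rw [h4, h5]
  · apply Measurable.lintegral_prod_right'
      (f := fun q : ℝ × G => F (act q.2⁻¹ e0, act q.2⁻¹ (yt q.1)))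
    exact hm.comp (g := fun q : (En 3 × En 3) × G => F (act q.2⁻¹ q.1.1, act q.2⁻¹ q.1.2))
      (f := fun q : ℝ × G => ((e0, yt q.1), q.2))
      (Measurable.prodMk (measurable_const.prodMk (measurable_yt.comp measurable_fst)) measurable_snd)

lemma eq_of_inv (P Q : Measure (En 3 × En 3)) [IsFiniteMeasure P] [IsFiniteMeasure Q]
    (hP : ∀ R : En 3 ≃ₗᵢ[ℝ] En 3, P.map (Prod.map R R) = P)
    (hPS : ∀ᵐ p ∂P, ‖p.1‖ = 1 ∧ ‖p.2‖ = 1)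
    (hQ : ∀ R : En 3 ≃ₗᵢ[ℝ] En 3, Q.map (Prod.map R R) = Q)
    (hQS : ∀ᵐ p ∂Q, ‖p.1‖ = 1 ∧ ‖p.2‖ = 1)
    (h : P.map (fun p => ⟪p.1, p.2⟫) = Q.map (fun p => ⟪p.1, p.2⟫)) : P = Q := by
  apply Measure.ext_of_lintegral
  intro F hF
  have h1 := haar_avg act measurable_act act_surj P hP hPS F hF
  rw [h, ← haar_avg act measurable_act act_surj Q hQ hQS F hF] at h1
  rwa [ENNReal.mul_right_inj] at h1
  · exact (isOpen_univ.measure_pos _ Set.univ_nonempty).ne'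
  · exact measure_ne_top _ _

lemma sphere_meas_lt_top : (μH[2] : Measure (En 3)) (unitSphere 3) < ∞ := by
  let f : (Fin 2 → ℝ) → En 3 := fun p =>
    !₂[Real.sin (p 0), Real.cos (p 0) * Real.cos (p 1), Real.cos (p 0) * Real.sin (p 1)]
  have hf : ContDiff ℝ 1 f := by
    rw [contDiff_piLp]
    intro i
    fin_cases i <;> simp [f] <;> fun_prop
  have hc : IsCompact (Set.Icc (fun _ => -4 : Fin 2 → ℝ) (fun _ => 4)) := isCompact_Icc
  obtain ⟨K, hK⟩ := (hf.contDiffOn (s := Set.Icc (fun _ => -4 : Fin 2 → ℝ) (fun _ => 4))).exists_lipschitzOnWith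
    (by norm_num) (convex_Icc _ _) hc
  have hsub : unitSphere 3 ⊆ f '' Set.Icc (fun _ => -4 : Fin 2 → ℝ) (fun _ => 4) := by
    intro x hx
    have hx' : ‖x‖ = 1 := by simpa [unitSphere] using hx
    have hx2 : x 0 ^ 2 + x 1 ^ 2 + x 2 ^ 2 = 1 := by
      have := EuclideanSpace.norm_sq_eq x
      rw [hx'] at this
      simpa [Fin.sum_univ_three] using this.symm
    have hpi := Real.pi_le_four
    have h0 : -1 ≤ x 0 := by nlinarith [sq_nonneg (x 1), sq_nonneg (x 2)]
    have h1 : x 0 ≤ 1 := by nlinarith [sq_nonneg (x 1), sq_nonneg (x 2)]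
    let w : ℂ := ⟨x 1, x 2⟩
    have hw : ‖w‖ = √(1 - x 0 ^ 2) := by
      rw [Complex.norm_def, Complex.normSq_apply]
      congr 1
      simp only [w]; linarith
    refine ⟨![Real.arcsin (x 0), Complex.arg w], ?_, ?_⟩
    · have a1 := Real.neg_pi_div_two_le_arcsin (x 0)
      have a2 := Real.arcsin_le_pi_div_two (x 0)
      have a3 := Complex.neg_pi_lt_arg w
      have a4 := Complex.arg_le_pi w
      constructor <;> intro i <;> fin_cases i <;> simp <;> linarith
    · ext i
      fin_cases i
      · simp [f, Real.sin_arcsin h0 h1]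
      · simp [f, Real.cos_arcsin, ← hw, Complex.norm_mul_cos_arg]; rfl
      · simp [f, Real.cos_arcsin, ← hw, Complex.norm_mul_sin_arg]; rfl
  refine (measure_mono hsub).trans_lt ?_
  refine (hK.hausdorffMeasure_image_le (d := 2) (by norm_num)).trans_lt ?_
  have : (μH[2] : Measure (Fin 2 → ℝ)) = volume := by
    have := hausdorffMeasure_pi_real (ι := Fin 2)
    simpa using this
  rw [this]
  exact ENNReal.mul_lt_top (by simp) hc.measure_lt_top

lemma sphere_meas_pos : (μH[2] : Measure (En 3)) (unitSphere 3) ≠ 0 := by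
  let f : En 3 → (Fin 2 → ℝ) := fun x => ![x 0, x 1]
  have hf : LipschitzWith 1 f := by
    apply LipschitzWith.of_dist_le_mul
    intro x y
    rw [NNReal.coe_one, one_mul, dist_pi_le_iff dist_nonneg]
    intro i
    fin_cases i
    · exact (by simpa [dist_eq_norm, f] using PiLp.norm_apply_le (x - y) 0)
    · exact (by simpa [dist_eq_norm, f] using PiLp.norm_apply_le (x - y) 1)
  have hsub : Metric.ball (0 : Fin 2 → ℝ) (1 / 2) ⊆ f '' unitSphere 3 := by
    intro p hp
    rw [mem_ball_zero_iff, pi_norm_lt_iff (by norm_num)] at hp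
    have h0 := abs_lt.mp (hp 0)
    have h1 := abs_lt.mp (hp 1)
    refine ⟨!₂[p 0, p 1, √(1 - p 0 ^ 2 - p 1 ^ 2)], ?_, ?_⟩
    · have : 0 ≤ 1 - p 0 ^ 2 - p 1 ^ 2 := by nlinarith
      simp [unitSphere, EuclideanSpace.norm_eq, Fin.sum_univ_three, Real.sq_sqrt this]
    · ext i; fin_cases i <;> simp [f]
  intro h
  have h2 := hf.hausdorffMeasure_image_le (d := 2) (by norm_num) (unitSphere 3)
  have : (μH[2] : Measure (Fin 2 → ℝ)) = volume := by
    have := hausdorffMeasure_pi_real (ι := Fin 2)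
    simpa using this
  rw [h, mul_zero, this] at h2
  have h3 := (measure_mono hsub).trans h2
  exact (Metric.measure_ball_pos volume (0 : Fin 2 → ℝ) (by norm_num : (0 : ℝ) < 1 / 2)).not_ge h3

lemma three_sub : ((3 : ℕ) : ℝ) - 1 = 2 := by norm_num

instance : IsProbabilityMeasure (sigmaN 3) := by
  constructor
  rw [sigmaN, three_sub]
  simp only [Measure.smul_apply, Measure.restrict_apply_univ, smul_eq_mul]
  exact ENNReal.inv_mul_cancel sphere_meas_pos sphere_meas_lt_top.ne

lemma measSet_unitSphere : MeasurableSet (unitSphere 3) := Metric.isClosed_sphere.measurableSet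

lemma sigma_ae : ∀ᵐ v ∂(sigmaN 3), ‖v‖ = 1 := by
  rw [sigmaN]
  apply Measure.ae_smul_measure
  filter_upwards [ae_restrict_mem measSet_unitSphere] with v hv
  simpa [unitSphere] using hv

lemma hausdorff_map (R : En 3 ≃ₗᵢ[ℝ] En 3) :
    (μH[2] : Measure (En 3)).map R = μH[2] :=
  (R.toIsometryEquiv.measurePreserving_hausdorffMeasure 2).map_eq

lemma sigma_map (R : En 3 ≃ₗᵢ[ℝ] En 3) : (sigmaN 3).map R = sigmaN 3 := by
  have h := ((R.toIsometryEquiv.measurePreserving_hausdorffMeasure 2).restrict_preimage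
    measSet_unitSphere).map_eq
  have h2 : R.toIsometryEquiv ⁻¹' (unitSphere 3) = unitSphere 3 := by
    ext x; simp [unitSphere]
  rw [h2] at h
  rw [sigmaN, three_sub, Measure.map_smul]
  congr 1

lemma measSet_disc (v : En 3) : MeasurableSet (disc 3 v) := by
  have h1 : MeasurableSet {z : En 3 | ⟪v, z⟫ = 0} :=
    measurableSet_eq_fun (by fun_prop) (by fun_prop)
  have h2 : MeasurableSet {z : En 3 | ‖z‖ < 1} :=
    measurableSet_lt (by fun_prop) (by fun_prop)
  exact h1.inter h2

lemma lambda_map (R : En 3 ≃ₗᵢ[ℝ] En 3) (v : En 3) :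
    (lambdaN 3 v).map R = lambdaN 3 (R v) := by
  have h := ((R.toIsometryEquiv.measurePreserving_hausdorffMeasure 2).restrict_preimage
    (measSet_disc (R v))).map_eq
  have h2 : R.toIsometryEquiv ⁻¹' (disc 3 (R v)) = disc 3 v := by
    ext x; simp [disc]
  rw [h2] at h
  have h3 := R.toIsometryEquiv.hausdorffMeasure_preimage 2 (disc 3 (R v))
  rw [h2] at h3
  rw [lambdaN, lambdaN, three_sub, Measure.map_smul, h3]
  congr 1

/-- Isometric embedding of the plane as `e0⊥`. -/
def iot (w : En 2) : En 3 := !₂[0, w 0, w 1]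

lemma iot_norm (w : En 2) : ‖iot w‖ = ‖w‖ := by
  simp [iot, EuclideanSpace.norm_eq, Fin.sum_univ_three]

lemma iot_isometry : Isometry iot := by
  apply Isometry.of_dist_eq
  intro x y
  rw [dist_eq_norm, dist_eq_norm, ← iot_norm]
  congr 1
  ext i; fin_cases i <;> simp [iot]

lemma iot_image (S : Set ℝ) : iot '' {w | ‖w‖ ∈ S} = {z : En 3 | ⟪e0, z⟫ = 0 ∧ ‖z‖ ∈ S} := by
  ext z
  constructor
  · rintro ⟨w, hw, rfl⟩
    refine ⟨by rw [inner_e0]; simp [iot], by simpa [iot_norm] using hw⟩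
  · rintro ⟨h1, h2⟩
    rw [inner_e0] at h1
    have : iot !₂[z 1, z 2] = z := by
      ext i; fin_cases i <;> simp [iot, h1]
    refine ⟨!₂[z 1, z 2], ?_, this⟩
    rw [Set.mem_ofPred_eq, ← iot_norm, this]; exact h2

lemma haus2 : (μH[2] : Measure (En 2)).IsAddHaarMeasure := by
  have := isAddHaarMeasure_hausdorffMeasure (E := En 2)
  simpa using this

lemma haus_cap (S : Set ℝ) : (μH[2] : Measure (En 3)) {z : En 3 | ⟪e0, z⟫ = 0 ∧ ‖z‖ ∈ S} =
    (μH[2] : Measure (En 2)) {w | ‖w‖ ∈ S} := by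
  rw [← iot_image, iot_isometry.hausdorffMeasure_image (Or.inl (by norm_num))]

lemma haus_disc : (μH[2] : Measure (En 3)) (disc 3 e0) = (μH[2] : Measure (En 2)) (Metric.ball 0 1) := by
  have := haus_cap (Set.Iio 1)
  simpa [disc, Metric.ball] using this

lemma haus_disc_ne : (μH[2] : Measure (En 3)) (disc 3 e0) ≠ 0 ∧ (μH[2] : Measure (En 3)) (disc 3 e0) ≠ ∞ := by
  have := haus2
  rw [haus_disc]
  exact ⟨(Metric.measure_ball_pos _ _ one_pos).ne', measure_ball_lt_top.ne⟩

instance : IsProbabilityMeasure (lambdaN 3 e0) := by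
  constructor
  rw [lambdaN, three_sub]
  simp only [Measure.smul_apply, Measure.restrict_apply_univ, smul_eq_mul]
  exact ENNReal.inv_mul_cancel haus_disc_ne.1 haus_disc_ne.2

lemma lambda_ae (v : En 3) : ∀ᵐ z ∂(lambdaN 3 v), ⟪v, z⟫ = 0 ∧ ‖z‖ < 1 := by
  rw [lambdaN]
  apply Measure.ae_smul_measure
  exact ae_restrict_mem (measSet_disc v)

lemma lambda_le (r : ℝ) (hr : 0 ≤ r) (hr1 : r < 1) :
    lambdaN 3 e0 {z | ‖z‖ ≤ r} = ENNReal.ofReal (r ^ 2) := by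
  have := haus2
  rw [lambdaN, three_sub]
  rw [Measure.smul_apply, Measure.restrict_apply (measurableSet_le (by fun_prop) (by fun_prop))]
  have : {z : En 3 | ‖z‖ ≤ r} ∩ disc 3 e0 = {z : En 3 | ⟪e0, z⟫ = 0 ∧ ‖z‖ ∈ Set.Iic r} := by
    ext z
    simp only [disc, Set.mem_inter_iff, Set.mem_ofPred_eq, Set.mem_Iic]
    constructor
    · tauto
    · rintro ⟨h1, h2⟩; exact ⟨h2, h1, h2.trans_lt hr1⟩
  rw [this, haus_cap]
  have h2 : {w : En 2 | ‖w‖ ∈ Set.Iic r} = Metric.closedBall 0 r := by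
    ext; simp
  rw [h2, Measure.addHaar_closedBall _ _ hr, smul_eq_mul, mul_comm, mul_assoc, ← haus_disc,
    ENNReal.mul_inv_cancel haus_disc_ne.1 haus_disc_ne.2, mul_one]
  simp

lemma diag_inv (τ : Measure (En 3)) (hinv : ∀ R : En 3 ≃ₗᵢ[ℝ] En 3, τ.map R = τ)
    (R : En 3 ≃ₗᵢ[ℝ] En 3) :
    (τ.map (fun x => (x, x))).map (Prod.map R R) = τ.map (fun x => (x, x)) := by
  have hR := R.continuous.measurable
  rw [Measure.map_map (hR.prodMap hR) (by fun_prop)]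
  conv_rhs => rw [← hinv R]
  rw [Measure.map_map (by fun_prop) hR]
  rfl

lemma diag_law (τ : Measure (En 3)) [IsProbabilityMeasure τ] (hn : ∀ᵐ v ∂τ, ‖v‖ = 1) :
    (τ.map (fun x => (x, x))).map (fun p : En 3 × En 3 => ⟪p.1, p.2⟫) = Measure.dirac 1 := by
  rw [Measure.map_map (by fun_prop) (by fun_prop)]
  rw [Measure.map_congr (g := fun _ => (1 : ℝ))]
  · simp [Measure.map_const]
  · filter_upwards [hn] with v hv
    simp [hv]

lemma sigma_unique (τ : Measure (En 3)) [IsProbabilityMeasure τ]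
    (hinv : ∀ R : En 3 ≃ₗᵢ[ℝ] En 3, τ.map R = τ) (hn : ∀ᵐ v ∂τ, ‖v‖ = 1) : τ = sigmaN 3 := by
  have hd : Measurable (fun x : En 3 => (x, x)) := by fun_prop
  have hns : MeasurableSet {p : En 3 × En 3 | ‖p.1‖ = 1 ∧ ‖p.2‖ = 1} := by
    have h1 : MeasurableSet {p : En 3 × En 3 | ‖p.1‖ = 1} :=
      measurableSet_eq_fun (by fun_prop) (by fun_prop)
    have h2 : MeasurableSet {p : En 3 × En 3 | ‖p.2‖ = 1} :=
      measurableSet_eq_fun (by fun_prop) (by fun_prop)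
    exact h1.inter h2
  have := eq_of_inv (τ.map (fun x => (x, x))) ((sigmaN 3).map (fun x => (x, x)))
    (diag_inv τ hinv)
    ((ae_map_iff hd.aemeasurable hns).2 (by filter_upwards [hn] with v hv using ⟨hv, hv⟩))
    (diag_inv _ sigma_map)
    ((ae_map_iff hd.aemeasurable hns).2 (by filter_upwards [sigma_ae] with v hv using ⟨hv, hv⟩))
    (by rw [diag_law _ hn, diag_law _ sigma_ae])
  have h2 := congrArg (Measure.map Prod.fst) this
  rw [Measure.map_map measurable_fst hd, Measure.map_map measurable_fst hd] at h2
  have h3 : (Prod.fst ∘ fun x : En 3 => (x, x)) = id := rfl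
  rwa [h3, Measure.map_id, Measure.map_id] at h2

lemma vol_fubini (D : Set (En 3)) (hD : MeasurableSet D) :
    volume D = ∫⁻ s, volume {w : En 2 | (!₂[s, w 0, w 1] : En 3) ∈ D} := by
  have h1 := (volume_preserving_piFinSuccAbove (fun _ : Fin 3 => ℝ) 0).symm
  have h2 := (PiLp.volume_preserving_toLp (Fin 3)).comp h1
  have h3 := h2.comp ((MeasurePreserving.id (volume : Measure ℝ)).prod
    (PiLp.volume_preserving_ofLp (Fin 2)))
  rw [← h3.measure_preimage hD.nullMeasurableSet,
    Measure.prod_apply (h3.measurable hD)]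
  congr 1
  ext s
  congr 1
  ext w
  simp only [Set.mem_preimage]
  have : (!₂[s, w 0, w 1] : En 3) = ((WithLp.toLp 2 ∘ (MeasurableEquiv.piFinSuccAbove (fun _ : Fin 3 => ℝ) 0).symm) ∘
      Prod.map id WithLp.ofLp) (s, w) := by
    ext i
    fin_cases i <;> rfl
  rw [Set.mem_ofPred_eq, this]

lemma nsq2 (w : En 2) : ‖w‖ ^ 2 = w 0 ^ 2 + w 1 ^ 2 := by
  simp [EuclideanSpace.norm_sq_eq]

lemma nsq3 (s : ℝ) (w : En 2) : ‖(!₂[s, w 0, w 1] : En 3)‖ ^ 2 = s ^ 2 + ‖w‖ ^ 2 := by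
  rw [nsq2]
  simp [EuclideanSpace.norm_sq_eq, Fin.sum_univ_three, add_assoc]

lemma area_lt (c : ℝ) (hc : 0 ≤ c) : volume {w : En 2 | ‖w‖ ^ 2 < c} = ENNReal.ofReal (π * c) := by
  have : {w : En 2 | ‖w‖ ^ 2 < c} = Metric.ball 0 (√c) := by
    ext w; simp [Real.lt_sqrt]
  rw [this, EuclideanSpace.volume_ball_fin_two, ← ENNReal.ofReal_pow (Real.sqrt_nonneg _),
    Real.sq_sqrt hc, mul_comm, ENNReal.ofReal_mul Real.pi_pos.le]

lemma area_le (c : ℝ) (hc : 0 ≤ c) : volume {w : En 2 | ‖w‖ ^ 2 ≤ c} = ENNReal.ofReal (π * c) := by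
  have : {w : En 2 | ‖w‖ ^ 2 ≤ c} = Metric.closedBall 0 (√c) := by
    ext w; simp [Real.le_sqrt (norm_nonneg _), hc]
  rw [this, EuclideanSpace.volume_closedBall_fin_two, ← ENNReal.ofReal_pow (Real.sqrt_nonneg _),
    Real.sq_sqrt hc, mul_comm, ENNReal.ofReal_mul Real.pi_pos.le]

/-- The squared radius of the slice of a spherical sector. -/
def Asl (t s : ℝ) : ℝ := if s ≤ t then s ^ 2 * ((1 - t ^ 2) / t ^ 2) else 1 - s ^ 2

lemma Asl_nonneg (t s : ℝ) (ht1 : t ≤ 1) (hs : 0 < s) (hs1 : s ≤ 1) : 0 ≤ Asl t s := by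
  unfold Asl
  split_ifs with h
  · have : 0 ≤ 1 - t ^ 2 := by nlinarith
    positivity
  · nlinarith

lemma Asl_integral (t : ℝ) (ht : 0 ≤ t) (ht1 : t ≤ 1) :
    ∫⁻ s, Set.indicator (Set.Ioc 0 1) (fun s => ENNReal.ofReal (π * Asl t s)) s =
      ENNReal.ofReal (2 * π / 3 * (1 - t)) := by
  rw [lintegral_indicator measurableSet_Ioc]
  have hc1 : Set.EqOn (fun s => π * (s ^ 2 * ((1 - t ^ 2) / t ^ 2))) (fun s => π * Asl t s)
      (Set.Ioc 0 t) := by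
    intro s hs
    simp [Asl, hs.2]
  have hc2 : Set.EqOn (fun s => π * (1 - s ^ 2)) (fun s => π * Asl t s)
      (Set.Ioc t 1) := by
    intro s hs
    simp [Asl, not_le.2 hs.1]
  have hi1 : IntegrableOn (fun s => π * Asl t s) (Set.Ioc 0 t) := by
    apply IntegrableOn.congr_fun _ hc1 measurableSet_Ioc
    exact (Continuous.integrableOn_Ioc (by fun_prop))
  have hi2 : IntegrableOn (fun s => π * Asl t s) (Set.Ioc t 1) := by
    apply IntegrableOn.congr_fun _ hc2 measurableSet_Ioc
    exact (Continuous.integrableOn_Ioc (by fun_prop))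
  have hU : Set.Ioc 0 t ∪ Set.Ioc t 1 = Set.Ioc 0 1 := Set.Ioc_union_Ioc_eq_Ioc ht ht1
  rw [← ofReal_integral_eq_lintegral_ofReal]
  · congr 1
    rw [← hU, setIntegral_union (Set.Ioc_disjoint_Ioc_of_le le_rfl) measurableSet_Ioc hi1 hi2,
      ← setIntegral_congr_fun measurableSet_Ioc hc1, ← setIntegral_congr_fun measurableSet_Ioc hc2,
      ← intervalIntegral.integral_of_le ht, ← intervalIntegral.integral_of_le ht1]
    simp only [intervalIntegral.integral_const_mul, intervalIntegral.integral_mul_const]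
    rw [intervalIntegral.integral_sub (by simp) (by simp)]
    simp only [integral_pow, intervalIntegral.integral_const]
    rcases eq_or_lt_of_le ht with h | h
    · subst h; norm_num; ring
    · simp; field_simp; ring
  · rw [← hU]; exact hi1.union hi2
  · filter_upwards [ae_restrict_mem measurableSet_Ioc] with s hs
    exact mul_nonneg Real.pi_pos.le (Asl_nonneg t s ht1 hs.1 hs.2)

lemma vol_upper (t : ℝ) (ht : 0 ≤ t) (ht1 : t ≤ 1) :
    volume {u : En 3 | t * ‖u‖ ≤ u 0 ∧ ‖u‖ < 1} ≤ ENNReal.ofReal (2 * π / 3 * (1 - t)) := by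
  have h1 : MeasurableSet {u : En 3 | t * ‖u‖ ≤ u 0} :=
    measurableSet_le (by fun_prop) (by fun_prop)
  have h2 : MeasurableSet {u : En 3 | ‖u‖ < 1} :=
    measurableSet_lt (by fun_prop) (by fun_prop)
  have h3 : MeasurableSet {u : En 3 | t * ‖u‖ ≤ u 0 ∧ ‖u‖ < 1} := h1.inter h2
  rw [vol_fubini _ h3, ← Asl_integral t ht ht1]
  apply lintegral_mono_ae
  filter_upwards [Measure.ae_ne volume (0 : ℝ)] with s hs0
  by_cases hs : s ∈ Set.Ioc (0 : ℝ) 1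
  · rw [Set.indicator_of_mem hs, ← area_le _ (Asl_nonneg t s ht1 hs.1 hs.2)]
    apply measure_mono
    rintro w ⟨hw1, hw2⟩
    have hn := nsq3 s w
    set N := ‖(!₂[s, w 0, w 1] : En 3)‖
    have hN : 0 ≤ N := norm_nonneg _
    simp only [Set.mem_ofPred_eq] at hw1 hw2 ⊢
    replace hw1 : t * N ≤ s := hw1
    unfold Asl
    split_ifs with h
    · have ht0 : 0 < t := hs.1.trans_le h
      rw [← mul_div_assoc, le_div_iff₀ (by positivity)]
      have : (t * N) ^ 2 ≤ s ^ 2 := by gcongr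
      nlinarith
    · nlinarith
  · rw [Set.indicator_of_notMem hs]
    rw [nonpos_iff_eq_zero]
    convert measure_empty (μ := (volume : Measure (En 2)))
    rw [Set.eq_empty_iff_forall_notMem]
    rintro w ⟨hw1, hw2⟩
    have hn := nsq3 s w
    set N := ‖(!₂[s, w 0, w 1] : En 3)‖
    have hN : 0 ≤ N := norm_nonneg _
    replace hw2 : N < 1 := hw2
    replace hw1 : t * N ≤ s := hw1
    have : 0 ≤ s := le_trans (by positivity) hw1
    apply hs
    refine ⟨lt_of_le_of_ne this (Ne.symm hs0), ?_⟩
    nlinarith [sq_nonneg ‖w‖]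

lemma vol_lower (t : ℝ) (ht : 0 ≤ t) (ht1 : t ≤ 1) :
    ENNReal.ofReal (2 * π / 3 * (1 - t)) ≤ volume {u : En 3 | t * ‖u‖ < u 0 ∧ ‖u‖ < 1} := by
  have h1 : MeasurableSet {u : En 3 | t * ‖u‖ < u 0} :=
    measurableSet_lt (by fun_prop) (by fun_prop)
  have h2 : MeasurableSet {u : En 3 | ‖u‖ < 1} :=
    measurableSet_lt (by fun_prop) (by fun_prop)
  have h3 : MeasurableSet {u : En 3 | t * ‖u‖ < u 0 ∧ ‖u‖ < 1} := h1.inter h2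
  rw [vol_fubini _ h3, ← Asl_integral t ht ht1]
  apply lintegral_mono
  intro s
  by_cases hs : s ∈ Set.Ioc (0 : ℝ) 1
  · rw [Set.indicator_of_mem hs, ← area_lt _ (Asl_nonneg t s ht1 hs.1 hs.2)]
    apply measure_mono
    intro w hw
    have hn := nsq3 s w
    have hN : 0 ≤ ‖(!₂[s, w 0, w 1] : En 3)‖ := norm_nonneg _
    have hs0 := hs.1
    change t * ‖(!₂[s, w 0, w 1] : En 3)‖ < s ∧ ‖(!₂[s, w 0, w 1] : En 3)‖ < 1
    set N := ‖(!₂[s, w 0, w 1] : En 3)‖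
    rw [Set.mem_ofPred_eq, Asl] at hw
    split_ifs at hw with h
    · have ht0 : 0 < t := hs.1.trans_le h
      rw [← mul_div_assoc, lt_div_iff₀ (by positivity)] at hw
      have h3 : (t * N) ^ 2 < s ^ 2 := by nlinarith
      have h4 : t * N < s := lt_of_pow_lt_pow_left₀ 2 hs0.le h3
      exact ⟨h4, by nlinarith⟩
    · have h3 : N < 1 := by nlinarith
      exact ⟨by nlinarith, h3⟩
  · rw [Set.indicator_of_notMem hs]
    exact zero_le

/-- Radial projection. -/
def nrm (u : En 3) : En 3 := ‖u‖⁻¹ • u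

lemma measurable_nrm : Measurable nrm := by unfold nrm; fun_prop

/-- The distribution of the direction of a uniform point of the ball. -/
def tauB : Measure (En 3) :=
  (volume (Metric.ball (0 : En 3) 1))⁻¹ • (volume.restrict (Metric.ball (0 : En 3) 1)).map nrm

lemma vol_ball3 : volume (Metric.ball (0 : En 3) 1) = ENNReal.ofReal (π * 4 / 3) := by
  simp

lemma vol_ball3_ne : volume (Metric.ball (0 : En 3) 1) ≠ 0 :=
  (Metric.measure_ball_pos _ _ one_pos).ne'

lemma vol_ball3_top : volume (Metric.ball (0 : En 3) 1) ≠ ∞ := measure_ball_lt_top.ne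

instance : IsProbabilityMeasure tauB := by
  constructor
  rw [tauB, Measure.smul_apply, Measure.map_apply measurable_nrm MeasurableSet.univ,
    Set.preimage_univ, Measure.restrict_apply_univ, smul_eq_mul]
  exact ENNReal.inv_mul_cancel vol_ball3_ne vol_ball3_top

lemma tauB_map (R : En 3 ≃ₗᵢ[ℝ] En 3) : tauB.map R = tauB := by
  have h := ((R.measurePreserving).restrict_preimage
    (measurableSet_ball (x := (0 : En 3)) (ε := 1))).map_eq
  have h2 : R ⁻¹' (Metric.ball (0 : En 3) 1) = Metric.ball (0 : En 3) 1 := by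
    ext x; simp
  rw [h2] at h
  have hR := R.continuous.measurable
  rw [tauB, Measure.map_smul, Measure.map_map hR measurable_nrm]
  congr 1
  conv_rhs => rw [← h]
  rw [Measure.map_map measurable_nrm hR]
  congr 1
  ext1 x
  simp [nrm]

lemma tauB_ae : ∀ᵐ v ∂tauB, ‖v‖ = 1 := by
  rw [tauB]
  apply Measure.ae_smul_measure
  rw [ae_map_iff measurable_nrm.aemeasurable (measurableSet_eq_fun (by fun_prop) (by fun_prop))]
  apply ae_restrict_of_ae
  filter_upwards [Measure.ae_ne volume (0 : En 3)] with u hu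
  simp [nrm, norm_smul, hu]

lemma tauB_eq : tauB = sigmaN 3 := sigma_unique tauB tauB_map tauB_ae

lemma sigma_apply (S : Set (En 3)) (hS : MeasurableSet S) :
    sigmaN 3 S = (ENNReal.ofReal (π * 4 / 3))⁻¹ * volume (nrm ⁻¹' S ∩ Metric.ball 0 1) := by
  rw [← tauB_eq, tauB, Measure.smul_apply, Measure.map_apply measurable_nrm hS,
    Measure.restrict_apply (measurable_nrm hS), vol_ball3, smul_eq_mul]

lemma cap_const (t : ℝ) : (ENNReal.ofReal (π * 4 / 3))⁻¹ * ENNReal.ofReal (2 * π / 3 * (1 - t)) =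
    ENNReal.ofReal ((1 - t) / 2) := by
  have := Real.pi_pos
  rw [← ENNReal.ofReal_inv_of_pos (by positivity), ← ENNReal.ofReal_mul (by positivity)]
  congr 1
  field_simp
  ring

lemma sigma_upper (t : ℝ) (ht : 0 ≤ t) (ht1 : t ≤ 1) :
    sigmaN 3 {y | t ≤ y 0} ≤ ENNReal.ofReal ((1 - t) / 2) := by
  rw [sigma_apply _ (measurableSet_le (by fun_prop) (by fun_prop)), ← cap_const]
  gcongr
  refine (measure_mono ?_).trans (vol_upper t ht ht1)
  rintro u ⟨h1, h2⟩
  refine ⟨?_, by simpa using h2⟩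
  have h1 : t ≤ ‖u‖⁻¹ * u 0 := h1
  rcases eq_or_ne u 0 with rfl | hu
  · simp
  · have : 0 < ‖u‖ := norm_pos_iff.2 hu
    rwa [mul_comm, ← div_eq_mul_inv, le_div_iff₀ this] at h1

lemma sigma_lower (t : ℝ) (ht : 0 ≤ t) (ht1 : t ≤ 1) :
    ENNReal.ofReal ((1 - t) / 2) ≤ sigmaN 3 {y | t < y 0} := by
  rw [sigma_apply _ (measurableSet_lt (by fun_prop) (by fun_prop)), ← cap_const]
  gcongr
  refine (vol_lower t ht ht1).trans (measure_mono ?_)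
  rintro u ⟨h1, h2⟩
  refine ⟨?_, by simpa using h2⟩
  change t < ‖u‖⁻¹ * u 0
  rcases eq_or_ne u 0 with rfl | hu
  · simp at h1
  · have : 0 < ‖u‖ := norm_pos_iff.2 hu
    rwa [mul_comm, ← div_eq_mul_inv, lt_div_iff₀ this]

lemma sigma_le (a : ℝ) (h1 : -1 ≤ a) (h2 : a < 1) :
    sigmaN 3 {y | y 0 ≤ a} = ENNReal.ofReal ((1 + a) / 2) := by
  have hsub : ∀ t : ℝ, sigmaN 3 {y | t < y 0} ≤ sigmaN 3 {y | t ≤ y 0} := fun t =>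
    measure_mono (fun y (hy : t < y 0) => show t ≤ y 0 from hy.le)
  rcases le_or_gt 0 a with h | h
  · have h3 : sigmaN 3 {y | a < y 0} = ENNReal.ofReal ((1 - a) / 2) :=
      le_antisymm ((hsub a).trans (sigma_upper a h h2.le)) (sigma_lower a h h2.le)
    have h4 : {y : En 3 | y 0 ≤ a} = {y : En 3 | a < y 0}ᶜ := by ext; simp
    rw [h4, prob_compl_eq_one_sub (measurableSet_lt (by fun_prop) (by fun_prop)), h3,
      ← ENNReal.ofReal_one, ← ENNReal.ofReal_sub _ (by linarith)]
    congr 1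
    ring
  · have h3 : sigmaN 3 {y | -a ≤ y 0} = ENNReal.ofReal ((1 + a) / 2) := by
      have := sigma_upper (-a) (by linarith) (by linarith)
      have h' := sigma_lower (-a) (by linarith) (by linarith)
      rw [sub_neg_eq_add] at this h'
      exact le_antisymm this (h'.trans (hsub _))
    rw [← h3, ← sigma_map (LinearIsometryEquiv.neg ℝ)]
    rw [Measure.map_apply (LinearIsometryEquiv.continuous _).measurable
      (measurableSet_le (by fun_prop) (by fun_prop)), sigma_map]
    congr 1
    ext y
    simp
    constructor <;> intro <;> linarith

lemma law_ext (μ ν : Measure ℝ) [IsProbabilityMeasure μ] [IsProbabilityMeasure ν]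
    (hμ : ∀ a, -1 ≤ a → a < 1 → μ (Set.Iic a) = ENNReal.ofReal ((1 + a) / 2))
    (hν : ∀ a, -1 ≤ a → a < 1 → ν (Set.Iic a) = ENNReal.ofReal ((1 + a) / 2))
    (hμ1 : ∀ᵐ x ∂μ, x ≤ 1) (hν1 : ∀ᵐ x ∂ν, x ≤ 1) : μ = ν := by
  apply Measure.ext_of_Iic
  intro a
  rcases lt_or_ge a (-1) with h | h
  · have aux : ∀ τ : Measure ℝ, τ (Set.Iic (-1)) = ENNReal.ofReal ((1 + -1) / 2) →
        τ (Set.Iic a) = 0 := by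
      intro τ hτ
      have : τ (Set.Iic a) ≤ τ (Set.Iic (-1)) := measure_mono (Set.Iic_subset_Iic.2 h.le)
      rw [hτ] at this
      simpa using this
    rw [aux μ (hμ _ le_rfl (by norm_num)), aux ν (hν _ le_rfl (by norm_num))]
  · rcases lt_or_ge a 1 with h' | h'
    · rw [hμ a h h', hν a h h']
    · have aux : ∀ τ : Measure ℝ, IsProbabilityMeasure τ → (∀ᵐ x ∂τ, x ≤ 1) →
        τ (Set.Iic a) = 1 := by
        intro τ _ hτ
        refine (mem_ae_iff_prob_eq_one measurableSet_Iic).1 ?_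
        filter_upwards [hτ] with x hx using hx.trans h'
      rw [aux μ inferInstance hμ1, aux ν inferInstance hν1]

/-- The reflection exchanging `v` and `e0`. -/
def Rf (v : En 3) : En 3 ≃ₗᵢ[ℝ] En 3 := Submodule.reflection (ℝ ∙ (e0 - v))ᗮ

lemma Rf_e0 (v : En 3) (hv : ‖v‖ = 1) : Rf v e0 = v :=
  Submodule.reflection_sub (by rw [hv, norm_e0])

lemma Rf_apply (v w : En 3) : Rf v w = w - (2 * (⟪e0 - v, w⟫ / ‖e0 - v‖ ^ 2)) • (e0 - v) := by
  rw [Rf, Submodule.reflection_orthogonal_apply, Submodule.reflection_singleton_apply]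
  simp [mul_smul, two_smul]

lemma measurable_Rf : Measurable (fun p : En 3 × En 3 => Rf p.1 p.2) := by
  simp only [Rf_apply]
  fun_prop

/-- Parametrization of the kinematic measure. -/
def Tk (p : En 3 × En 3) : En 3 × En 3 := (p.1, Rf p.1 p.2)

lemma measurable_Tk : Measurable Tk := measurable_fst.prodMk measurable_Rf

lemma lambda_eq (v : En 3) (hv : ‖v‖ = 1) : lambdaN 3 v = (lambdaN 3 e0).map (Rf v) := by
  rw [lambda_map, Rf_e0 v hv]

lemma kin_eq : kinematic 3 = ((sigmaN 3).prod (lambdaN 3 e0)).map Tk := by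
  have h1 : (fun v => (Measure.dirac v).prod (lambdaN 3 v)) =ᵐ[sigmaN 3]
      (fun v => (lambdaN 3 e0).map (fun w => Tk (v, w))) := by
    filter_upwards [sigma_ae] with v hv
    rw [lambda_eq v hv]
    have : IsProbabilityMeasure ((lambdaN 3 e0).map (Rf v)) :=
      Measure.isProbabilityMeasure_map (Rf v).continuous.measurable.aemeasurable
    rw [Measure.dirac_prod, Measure.map_map (by fun_prop) (Rf v).continuous.measurable]
    rfl
  rw [kinematic, Measure.bind_congr_right h1]
  have hT : ∀ v, Measurable (fun w => Tk (v, w)) := fun v => measurable_Tk.comp (by fun_prop)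
  have hm : Measurable (fun v => (lambdaN 3 e0).map (fun w => Tk (v, w))) := by
    apply Measure.measurable_of_measurable_coe
    intro s hs
    simp_rw [Measure.map_apply (hT _) hs]
    exact measurable_measure_prodMk_left (measurable_Tk hs)
  ext s hs
  rw [Measure.bind_apply hs hm.aemeasurable, Measure.map_apply measurable_Tk hs,
    Measure.prod_apply (measurable_Tk hs)]
  simp_rw [Measure.map_apply (hT _) hs]
  rfl

/-- The pair of end points. -/
def XY (p : En 3 × En 3) : En 3 × En 3 := (Xpt 3 p, Ypt 3 p)

lemma measurable_XY : Measurable XY := by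
  unfold XY Xpt Ypt
  fun_prop

/-- The distribution of the end points. -/
def QQ : Measure (En 3 × En 3) := (kinematic 3).map XY

instance : IsProbabilityMeasure (kinematic 3) := by
  rw [kin_eq]
  exact Measure.isProbabilityMeasure_map measurable_Tk.aemeasurable

instance : IsProbabilityMeasure QQ :=
  Measure.isProbabilityMeasure_map measurable_XY.aemeasurable

lemma QQ_lintegral (F : En 3 × En 3 → ℝ≥0∞) (hF : Measurable F) :
    ∫⁻ p, F p ∂QQ = ∫⁻ v, ∫⁻ z, F (XY (v, z)) ∂(lambdaN 3 v) ∂(sigmaN 3) := by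
  have h := hF.comp measurable_XY
  rw [QQ, lintegral_map hF measurable_XY, kin_eq, lintegral_map (f := fun a => F (XY a)) h measurable_Tk,
    lintegral_prod (f := fun a => F (XY (Tk a))) (h.comp measurable_Tk).aemeasurable]
  apply lintegral_congr_ae
  filter_upwards [sigma_ae] with v hv
  rw [lambda_eq v hv, lintegral_map (f := fun z => F (XY (v, z))) (h.comp (by fun_prop)) (Rf v).continuous.measurable]
  rfl

lemma XY_map (R : En 3 ≃ₗᵢ[ℝ] En 3) (v z : En 3) :
    Prod.map R R (XY (v, z)) = XY (R v, R z) := by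
  simp [XY, Xpt, Ypt]

lemma QQ_inv (R : En 3 ≃ₗᵢ[ℝ] En 3) : QQ.map (Prod.map R R) = QQ := by
  have hR := R.continuous.measurable
  apply Measure.ext_of_lintegral
  intro F hF
  rw [lintegral_map hF (hR.prodMap hR), QQ_lintegral _ hF,
    QQ_lintegral (fun a => F (Prod.map R R a)) (hF.comp (hR.prodMap hR))]
  have hE : ⇑(R.toIsometryEquiv.toHomeomorph.toMeasurableEquiv) = R := rfl
  conv_rhs => rw [← sigma_map R, ← hE, lintegral_map_equiv]
  apply lintegral_congr
  intro v
  rw [hE, ← lambda_map, lintegral_map (f := fun z => F (XY (R v, z))) ((hF.comp measurable_XY).comp (by fun_prop)) hR]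
  simp only [XY_map]

lemma good_ae : ∀ᵐ p ∂(kinematic 3), ‖p.1‖ = 1 ∧ ⟪p.1, p.2⟫ = 0 ∧ ‖p.2‖ < 1 := by
  have hms : MeasurableSet {p : En 3 × En 3 | ‖p.1‖ = 1 ∧ ⟪p.1, p.2⟫ = 0 ∧ ‖p.2‖ < 1} := by
    have h1 : MeasurableSet {p : En 3 × En 3 | ‖p.1‖ = 1} :=
      measurableSet_eq_fun (by fun_prop) (by fun_prop)
    have h2 : MeasurableSet {p : En 3 × En 3 | ⟪p.1, p.2⟫ = 0} :=
      measurableSet_eq_fun (by fun_prop) (by fun_prop)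
    have h3 : MeasurableSet {p : En 3 × En 3 | ‖p.2‖ < 1} :=
      measurableSet_lt (by fun_prop) (by fun_prop)
    exact h1.inter (h2.inter h3)
  rw [kin_eq, ae_map_iff measurable_Tk.aemeasurable hms]
  have h1 : ∀ᵐ p ∂((sigmaN 3).prod (lambdaN 3 e0)), ‖p.1‖ = 1 :=
    Measure.quasiMeasurePreserving_fst.ae sigma_ae
  have h2 : ∀ᵐ p ∂((sigmaN 3).prod (lambdaN 3 e0)), ⟪e0, p.2⟫ = 0 ∧ ‖p.2‖ < 1 :=
    Measure.quasiMeasurePreserving_snd.ae (lambda_ae e0)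
  filter_upwards [h1, h2] with p hp1 hp2
  refine ⟨hp1, ?_, by simpa [Tk] using hp2.2⟩
  have : ⟪Rf p.1 e0, Rf p.1 p.2⟫ = 0 := by rw [LinearIsometryEquiv.inner_map_map, hp2.1]
  rwa [Rf_e0 _ hp1] at this

lemma XY_alg (v z : En 3) (hv : ‖v‖ = 1) (hz : ⟪v, z⟫ = 0) (hz1 : ‖z‖ < 1) :
    ‖Xpt 3 (v, z)‖ = 1 ∧ ‖Ypt 3 (v, z)‖ = 1 ∧ ⟪Xpt 3 (v, z), Ypt 3 (v, z)⟫ = 2 * ‖z‖ ^ 2 - 1 := by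
  have hz' : ⟪z, v⟫ = 0 := by rw [real_inner_comm, hz]
  have h0 : 0 ≤ 1 - ‖z‖ ^ 2 := by nlinarith [norm_nonneg z]
  have hs := Real.sq_sqrt h0
  refine ⟨?_, ?_, ?_⟩
  · rw [← sq_eq_sq₀ (norm_nonneg _) zero_le_one, ← real_inner_self_eq_norm_sq]
    simp only [Xpt, inner_sub_left, inner_sub_right, real_inner_smul_left, real_inner_smul_right,
      hz, hz', real_inner_self_eq_norm_sq, norm_smul, mul_pow, hv, Real.norm_eq_abs, sq_abs]
    linarith
  · rw [← sq_eq_sq₀ (norm_nonneg _) zero_le_one, ← real_inner_self_eq_norm_sq]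
    simp only [Ypt, inner_add_left, inner_add_right, real_inner_smul_left, real_inner_smul_right,
      hz, hz', real_inner_self_eq_norm_sq, norm_smul, mul_pow, hv, Real.norm_eq_abs, sq_abs]
    linarith
  · simp only [Xpt, Ypt, inner_sub_left, inner_add_right, real_inner_smul_left,
      real_inner_smul_right, hz, hz', real_inner_self_eq_norm_sq, norm_smul, mul_pow, hv,
      Real.norm_eq_abs, sq_abs]
    linarith

lemma measSet_norms : MeasurableSet {p : En 3 × En 3 | ‖p.1‖ = 1 ∧ ‖p.2‖ = 1} := by
  have h1 : MeasurableSet {p : En 3 × En 3 | ‖p.1‖ = 1} :=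
    measurableSet_eq_fun (by fun_prop) (by fun_prop)
  have h2 : MeasurableSet {p : En 3 × En 3 | ‖p.2‖ = 1} :=
    measurableSet_eq_fun (by fun_prop) (by fun_prop)
  exact h1.inter h2

lemma QQ_ae : ∀ᵐ p ∂QQ, ‖p.1‖ = 1 ∧ ‖p.2‖ = 1 := by
  rw [QQ, ae_map_iff measurable_XY.aemeasurable measSet_norms]
  filter_upwards [good_ae] with p hp
  have := XY_alg p.1 p.2 hp.1 hp.2.1 hp.2.2
  exact ⟨this.1, this.2.1⟩

lemma QQ_law (a : ℝ) (h1 : -1 ≤ a) (h2 : a < 1) :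
    (QQ.map (fun p => ⟪p.1, p.2⟫)) (Set.Iic a) = ENNReal.ofReal ((1 + a) / 2) := by
  have hin : Measurable (fun p : En 3 × En 3 => ⟪p.1, p.2⟫) := by fun_prop
  rw [QQ, Measure.map_map hin measurable_XY]
  have hc : (fun p : En 3 × En 3 => ⟪p.1, p.2⟫) ∘ XY =ᵐ[kinematic 3]
      fun p => 2 * ‖p.2‖ ^ 2 - 1 := by
    filter_upwards [good_ae] with p hp
    exact (XY_alg p.1 p.2 hp.1 hp.2.1 hp.2.2).2.2
  have hm : Measurable (fun p : En 3 × En 3 => 2 * ‖p.2‖ ^ 2 - 1) := by fun_prop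
  rw [Measure.map_congr hc, kin_eq, Measure.map_map hm measurable_Tk,
    Measure.map_apply (hm.comp measurable_Tk) measurableSet_Iic]
  have hr : 0 ≤ (1 + a) / 2 := by linarith
  have : ((fun p : En 3 × En 3 => 2 * ‖p.2‖ ^ 2 - 1) ∘ Tk) ⁻¹' Set.Iic a =
      Set.univ ×ˢ {z : En 3 | ‖z‖ ≤ √((1 + a) / 2)} := by
    ext p
    simp only [Tk, Set.mem_preimage, Function.comp, LinearIsometryEquiv.norm_map, Set.mem_Iic,
      Set.mem_prod, Set.mem_univ, true_and, Set.mem_ofPred_eq, Real.le_sqrt (norm_nonneg _) hr]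
    constructor <;> intro <;> linarith
  rw [this, Measure.prod_prod, measure_univ, one_mul, lambda_le _ (Real.sqrt_nonneg _) ?_,
    Real.sq_sqrt hr]
  rw [Real.sqrt_lt' one_pos]
  linarith

lemma prod_inv (R : En 3 ≃ₗᵢ[ℝ] En 3) :
    ((sigmaN 3).prod (sigmaN 3)).map (Prod.map R R) = (sigmaN 3).prod (sigmaN 3) := by
  have hR := R.continuous.measurable
  rw [← Measure.map_prod_map _ _ hR hR, sigma_map]

lemma prod_ae : ∀ᵐ p ∂((sigmaN 3).prod (sigmaN 3)), ‖p.1‖ = 1 ∧ ‖p.2‖ = 1 := by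
  have h1 : ∀ᵐ p ∂((sigmaN 3).prod (sigmaN 3)), ‖p.1‖ = 1 :=
    Measure.quasiMeasurePreserving_fst.ae sigma_ae
  have h2 : ∀ᵐ p ∂((sigmaN 3).prod (sigmaN 3)), ‖p.2‖ = 1 :=
    Measure.quasiMeasurePreserving_snd.ae sigma_ae
  exact h1.and h2

lemma prod_law (a : ℝ) (h1 : -1 ≤ a) (h2 : a < 1) :
    (((sigmaN 3).prod (sigmaN 3)).map (fun p => ⟪p.1, p.2⟫)) (Set.Iic a) =
      ENNReal.ofReal ((1 + a) / 2) := by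
  have hin : Measurable (fun p : En 3 × En 3 => ⟪p.1, p.2⟫) := by fun_prop
  rw [Measure.map_apply hin measurableSet_Iic, Measure.prod_apply (hin measurableSet_Iic)]
  rw [lintegral_congr_ae (g := fun _ => ENNReal.ofReal ((1 + a) / 2))]
  · simp
  · filter_upwards [sigma_ae] with v hv
    rw [← sigma_le a h1 h2]
    conv_lhs => rw [← sigma_map (Rf v)]
    rw [Measure.map_apply (Rf v).continuous.measurable (measurable_prodMk_left (hin measurableSet_Iic))]
    congr 1
    ext y
    have : ⟪v, Rf v y⟫ = y 0 := by
      conv_lhs => rw [← Rf_e0 v hv]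
      rw [Rf_e0 v hv, ← inner_e0, ← LinearIsometryEquiv.inner_map_map (Rf v) e0, Rf_e0 v hv]
    simp [this]

lemma law_le_one (P : Measure (En 3 × En 3)) (h : ∀ᵐ p ∂P, ‖p.1‖ = 1 ∧ ‖p.2‖ = 1) :
    ∀ᵐ x ∂(P.map (fun p => ⟪p.1, p.2⟫)), x ≤ 1 := by
  have hin : Measurable (fun p : En 3 × En 3 => ⟪p.1, p.2⟫) := by fun_prop
  rw [ae_map_iff hin.aemeasurable measurableSet_Iic]
  filter_upwards [h] with p hp
  have := real_inner_le_norm p.1 p.2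
  rwa [hp.1, hp.2, one_mul] at this

lemma QQ_eq : QQ = (sigmaN 3).prod (sigmaN 3) := by
  have hin : Measurable (fun p : En 3 × En 3 => ⟪p.1, p.2⟫) := by fun_prop
  apply eq_of_inv _ _ QQ_inv QQ_ae prod_inv prod_ae
  have i1 := Measure.isProbabilityMeasure_map (μ := QQ) hin.aemeasurable
  have i2 := Measure.isProbabilityMeasure_map (μ := (sigmaN 3).prod (sigmaN 3)) hin.aemeasurable
  exact law_ext _ _ QQ_law prod_law (law_le_one _ QQ_ae) (law_le_one _ prod_ae)

/-- The probability that a random line intersects `A ⊆ S²` in both of its intersection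
points with the sphere equals `σ(A)²`. -/
theorem prob_both_points_in_A (A : Set (En 3)) (hA : MeasurableSet A)
    (hAS : A ⊆ unitSphere 3) :
    kinematic 3 {p : En 3 × En 3 | Xpt 3 p ∈ A ∧ Ypt 3 p ∈ A} = (sigmaN 3 A) ^ 2 := by
  have h1 : {p : En 3 × En 3 | Xpt 3 p ∈ A ∧ Ypt 3 p ∈ A} = XY ⁻¹' (A ×ˢ A) := rfl
  rw [h1, ← Measure.map_apply measurable_XY (hA.prod hA)]
  change QQ _ = _
  rw [QQ_eq, Measure.prod_prod, sq]

end
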